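/- Let H be a finite abelian group and let G be a controllable group shift over H. Then G is irreducible: there exists x ∈ G such that for every n₀ ∈ ℤ the partial forward orbit {σⁿ(x) : n ≥ n₀} is dense in G. -/

import Mathlib

open Function Topology

/-- The backward shift by `n`: `(shiftPow n x) i = x (i + n)`. -/
def shiftPow {H : Type*} (n : ℤ) (x : ℤ → H) : ℤ → H := fun i => x (i + n)

/-- The backward shift operator `σ`: `(shift x) i = x (i + 1)`. -/
abbrev shift {H : Type*} (x : ℤ → H) : ℤ → H := shiftPow 1 x

/-- A group shift over `H`: a closed, shift-invariant subgroup of the full shift `H^ℤ`. -/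
def IsGroupShift {H : Type*} [AddCommGroup H] [TopologicalSpace H]
    (G : AddSubgroup (ℤ → H)) : Prop :=
  IsClosed (G : Set (ℤ → H)) ∧ shift '' (G : Set (ℤ → H)) = (G : Set (ℤ → H))

/-- `G` is controllable. -/
def IsControllable {H : Type*} [AddCommGroup H] (G : AddSubgroup (ℤ → H)) : Prop :=
  ∃ n_c : ℕ, 0 < n_c ∧ ∀ g ∈ G, ∃ g₁ ∈ G,
    (∀ i : ℤ, i ≤ 0 → g₁ i = g i) ∧ (∀ i : ℤ, (n_c : ℤ) < i → g₁ i = 0)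

theorem continuous_shiftPow {H : Type*} [TopologicalSpace H] (n : ℤ) :
    Continuous (shiftPow n : (ℤ → H) → ℤ → H) :=
  continuous_pi fun i => continuous_apply (i + n)

theorem IsGroupShift.shiftPow_mem {H : Type*} [AddCommGroup H] [TopologicalSpace H]
    {G : AddSubgroup (ℤ → H)} (hG : IsGroupShift G) (n : ℤ) {x : ℤ → H} (hx : x ∈ G) :
    shiftPow n x ∈ G := by
  induction n using Int.induction_on with
  | zero =>
    have h : shiftPow 0 x = x := by
      funext i
      simp [shiftPow]
    rwa [h]
  | succ k ih =>
    have h : shiftPow (k + 1) x = shift (shiftPow k x) := by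
      funext i
      simp only [shiftPow]
      congr 1
      ring
    rw [h]
    exact hG.2.subset (Set.mem_image_of_mem _ ih)
  | pred k ih =>
    obtain ⟨y, hy, hyx⟩ : shiftPow (-k) x ∈ shift '' (G : Set (ℤ → H)) := hG.2.superset ih
    have h : shiftPow (-k - 1) x = y := by
      funext i
      have hi := congrFun hyx (i - 1)
      simp only [shiftPow, sub_add_cancel] at hi ⊢
      rw [hi]
      congr 1
      ring
    rwa [h]

/-- Controllability with the cut placed at an arbitrary time `m`. -/
theorem IsGroupShift.exists_eq_left_zero_right {H : Type*} [AddCommGroup H] [TopologicalSpace H]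
    {G : AddSubgroup (ℤ → H)} (hG : IsGroupShift G) {c : ℕ}
    (hc : ∀ g ∈ G, ∃ g₁ ∈ G,
      (∀ i : ℤ, i ≤ 0 → g₁ i = g i) ∧ (∀ i : ℤ, (c : ℤ) < i → g₁ i = 0))
    {g : ℤ → H} (hg : g ∈ G) (m : ℤ) :
    ∃ g₁ ∈ G, (∀ i : ℤ, i ≤ m → g₁ i = g i) ∧ (∀ i : ℤ, m + c < i → g₁ i = 0) := by
  obtain ⟨a, ha, hleft, hright⟩ := hc _ (hG.shiftPow_mem m hg)
  refine ⟨shiftPow (-m) a, hG.shiftPow_mem (-m) ha, fun i hi => ?_, fun i hi => ?_⟩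
  · simp only [shiftPow]
    rw [hleft _ (by omega)]
    simp [shiftPow]
  · exact hright _ (by omega)

/-- Any past of one configuration can be followed, after a prescribed time, by any finite
block of another. -/
theorem IsGroupShift.exists_eq_left_eq_block {H : Type*} [AddCommGroup H] [TopologicalSpace H]
    {G : AddSubgroup (ℤ → H)} (hG : IsGroupShift G) (hc : IsControllable G)
    {g h : ℤ → H} (hg : g ∈ G) (hh : h ∈ G) (m k n₀ : ℤ) :
    ∃ x ∈ G, (∀ i ≤ m, x i = g i) ∧ ∃ n ≥ n₀, ∀ i ≥ -k, shiftPow n x i = h i := by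
  obtain ⟨c, -, hc⟩ := hc
  obtain ⟨a, ha, ha_left, ha_right⟩ := hG.exists_eq_left_zero_right hc hg m
  obtain ⟨b, hb, hb_left, hb_right⟩ := hG.exists_eq_left_zero_right hc hh (-k - 1 - c)
  obtain ⟨n, hn, hn'⟩ : ∃ n : ℤ, n₀ ≤ n ∧ m + k + 1 + c ≤ n :=
    ⟨max n₀ (m + k + 1 + c), le_max_left _ _, le_max_right _ _⟩
  refine ⟨a + shiftPow (-n) (h - b), G.add_mem ha (hG.shiftPow_mem _ (G.sub_mem hh hb)),
    fun i hi => ?_, n, hn, fun i hi => ?_⟩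
  · simp only [shiftPow, Pi.add_apply, Pi.sub_apply]
    rw [ha_left i hi, hb_left _ (by omega), sub_self, add_zero]
  · simp only [shiftPow, Pi.add_apply, Pi.sub_apply]
    rw [ha_right _ (by omega), add_neg_cancel_right, hb_right i (by omega), zero_add, sub_zero]

/-- Controllable group shifts are topologically transitive in forward time. -/
theorem IsGroupShift.exists_mem_shiftPow_mem {H : Type*} [AddCommGroup H] [TopologicalSpace H]
    {G : AddSubgroup (ℤ → H)} (hG : IsGroupShift G) (hc : IsControllable G)
    {U V : Set (ℤ → H)} (hU : IsOpen U) (hV : IsOpen V)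
    (hGU : ((G : Set (ℤ → H)) ∩ U).Nonempty) (hGV : ((G : Set (ℤ → H)) ∩ V).Nonempty) (n₀ : ℤ) :
    ∃ x ∈ G, x ∈ U ∧ ∃ n ≥ n₀, shiftPow n x ∈ V := by
  obtain ⟨g, hg, hgU⟩ := hGU
  obtain ⟨h, hh, hhV⟩ := hGV
  obtain ⟨I, u, hu, hIU⟩ := isOpen_pi_iff.1 hU g hgU
  obtain ⟨J, v, hv, hJV⟩ := isOpen_pi_iff.1 hV h hhV
  obtain ⟨m, hm⟩ := I.bddAbove
  obtain ⟨k, hk⟩ := J.bddBelow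
  obtain ⟨x, hx, hxg, n, hn, hxh⟩ := hG.exists_eq_left_eq_block hc hg hh m (-k) n₀
  refine ⟨x, hx, hIU fun i hi => ?_, n, hn, hJV fun i hi => ?_⟩
  · rw [hxg i (hm hi)]
    exact (hu i hi).2
  · rw [hxh i (by simpa using hk hi)]
    exact (hv i hi).2

/-- Every controllable group shift `G` over a finite abelian group is
irreducible: there is `x ∈ G` such that for every `n₀ ∈ ℤ` the partial forward orbit
`{σⁿ(x) : n ≥ n₀}` is dense in `G`. -/
theorem controllable_irreducible
    {H : Type} [AddCommGroup H] [Fintype H] [TopologicalSpace H] [DiscreteTopology H]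
    (G : AddSubgroup (ℤ → H)) (hG : IsGroupShift G) (hc : IsControllable G) :
    ∃ x ∈ G, ∀ n₀ : ℤ,
      (G : Set (ℤ → H)) ⊆ closure {y : ℤ → H | ∃ n : ℤ, n₀ ≤ n ∧ y = shiftPow n x} := by
  let B := TopologicalSpace.countableBasis (ℤ → H)
  have hB : TopologicalSpace.IsTopologicalBasis B :=
    TopologicalSpace.isBasis_countableBasis (ℤ → H)
  have : Countable B := (TopologicalSpace.countable_countableBasis (ℤ → H)).to_subtype
  have : CompactSpace G := isCompact_iff_compactSpace.1 hG.1.isCompact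
  let O : B × ℤ → Set G := fun p =>
    {x | ((G : Set (ℤ → H)) ∩ p.1).Nonempty → ∃ n ≥ p.2, shiftPow n (x : ℤ → H) ∈ p.1.1}
  have hO_open (p : B × ℤ) : IsOpen (O p) := by
    by_cases hp : ((G : Set (ℤ → H)) ∩ p.1).Nonempty
    · have : O p = ⋃ n ≥ p.2, (fun x : G => shiftPow n (x : ℤ → H)) ⁻¹' p.1.1 := by
        ext x
        simp [O, hp]
      rw [this]
      exact isOpen_biUnion fun n _ => (hB.isOpen p.1.2).preimage
        ((continuous_shiftPow n).comp continuous_subtype_val)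
    · simp [O, hp]
  have hO_dense (p : B × ℤ) : Dense (O p) := by
    by_cases hp : ((G : Set (ℤ → H)) ∩ p.1).Nonempty
    · rw [dense_iff_inter_open]
      rintro _ ⟨U, hU, rfl⟩ ⟨g, hg⟩
      obtain ⟨x, hx, hxU, hxV⟩ :=
        hG.exists_mem_shiftPow_mem hc hU (hB.isOpen p.1.2) ⟨g, g.2, hg⟩ hp p.2
      exact ⟨⟨x, hx⟩, hxU, fun _ => hxV⟩
    · simp [O, hp]
  obtain ⟨x, hx⟩ := (dense_iInter_of_isOpen hO_open hO_dense).nonempty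
  refine ⟨x, x.2, fun n₀ g hg => hB.mem_closure_iff.2 fun U hU hgU => ?_⟩
  obtain ⟨n, hn, hnU⟩ := Set.mem_iInter.1 hx (⟨U, hU⟩, n₀) ⟨g, hg, hgU⟩
  exact ⟨_, hnU, n, hn, rfl⟩
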